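/- arXiv:2111.06733 — 6 statements merged into one kernel-verified Lean document; each statement's English description precedes it below -/
import Mathlib

section
/- Let M and J be finite sets, let K be a finite index set, and for each j ∈ J let r_j be the rank function of a matroid on M, let (M_{jk})_{k∈K} be pairwise disjoint subsets of M, and let d_{jk} ∈ ℕ. Define r'_j(U) := Σ_{k∈K} min{r_j(U ∩ M_{jk}), d_{jk}} for U ⊆ M. Then every extreme point of the polytope P := {y ∈ ℝ_{≥0}^{M×J} : Σ_{j∈J} y_{ij} ≤ 26 for all i ∈ M, and Σ_{i∈U} y_{ij} ≤ r'_j(U) for all U ⊆ M and j ∈ J} has all integer coordinates. (First part of Lemma 10.) -/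
open Finset
open scoped Classical

/-- `F` is a matroid on ground set `M`: nonempty, downward closed, with the exchange
property. -/
def IsMatroid {M : Type} [DecidableEq M] (F : Set (Finset M)) : Prop :=
  F.Nonempty ∧ (∀ S T : Finset M, T ∈ F → S ⊆ T → S ∈ F) ∧
    ∀ S ∈ F, ∀ T ∈ F, S.card < T.card → ∃ i ∈ T \ S, insert i S ∈ F

/-- The rank function of `F`: `r(U) = max {|S| : S ⊆ U, S ∈ F}`. -/
noncomputable def rankFn {M : Type} [Fintype M] (F : Set (Finset M)) (U : Finset M) : ℕ :=
  (Finset.univ.filter (fun S : Finset M => S ⊆ U ∧ S ∈ F)).sup Finset.card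

/-- Membership in the polytope `P` of Lemma 10: `y ≥ 0`, `∑_j y_{ij} ≤ 26` for every
machine `i`, and `∑_{i ∈ U} y_{ij} ≤ r'_j(U) = ∑_k min{r_j(U ∩ M_{jk}), d_{jk}}` for
every `U ⊆ M` and `j`. -/
def memP {M J K : Type} [Fintype M] [Fintype J] [Fintype K] [DecidableEq M]
    (F : J → Set (Finset M)) (Mk : J → K → Finset M) (d : J → K → ℕ)
    (y : M → J → ℝ) : Prop :=
  (∀ (i : M) (j : J), 0 ≤ y i j) ∧
  (∀ i : M, ∑ j : J, y i j ≤ 26) ∧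
  (∀ (j : J) (U : Finset M),
    ∑ i ∈ U, y i j ≤ ((∑ k : K, min (rankFn (F j) (U ∩ Mk j k)) (d j k) : ℕ) : ℝ))

lemma rank_ge {M : Type} [Fintype M] (F : Set (Finset M)) {S U : Finset M} (h : S ⊆ U) (hS : S ∈ F) :
    S.card ≤ rankFn F U := by
  unfold rankFn
  exact Finset.le_sup (f := Finset.card) (by simp [h, hS])

lemma rank_attain {M : Type} [Fintype M] [DecidableEq M] (F : Set (Finset M)) (hF : IsMatroid F)
    (U : Finset M) : ∃ S, S ⊆ U ∧ S ∈ F ∧ S.card = rankFn F U := by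
  have he : (∅ : Finset M) ∈ F := by
    obtain ⟨T, hT⟩ := hF.1
    exact hF.2.1 _ T hT (by simp)
  have hne : (Finset.univ.filter (fun S : Finset M => S ⊆ U ∧ S ∈ F)).Nonempty :=
    ⟨∅, by simp [he]⟩
  obtain ⟨S, hS, h⟩ := Finset.exists_mem_eq_sup _ hne Finset.card
  simp only [Finset.mem_filter, Finset.mem_univ, true_and] at hS
  exact ⟨S, hS.1, hS.2, by unfold rankFn; convert h.symm⟩

lemma rank_extend {M : Type} [Fintype M] [DecidableEq M] (F : Set (Finset M)) (hF : IsMatroid F)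
    (B U : Finset M) (hB : B ∈ F) (hBU : B ⊆ U) :
    ∃ S, B ⊆ S ∧ S ⊆ U ∧ S ∈ F ∧ S.card = rankFn F U := by
  obtain ⟨S, hS, hmax⟩ := Finset.exists_max_image
    (Finset.univ.filter (fun S : Finset M => B ⊆ S ∧ S ⊆ U ∧ S ∈ F)) Finset.card
    ⟨B, by simp [hB, hBU]⟩
  simp only [Finset.mem_filter, Finset.mem_univ, true_and] at hS hmax
  refine ⟨S, hS.1, hS.2.1, hS.2.2, le_antisymm (rank_ge F hS.2.1 hS.2.2) ?_⟩
  by_contra! hlt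
  obtain ⟨T, hTU, hT, hTc⟩ := rank_attain F hF U
  obtain ⟨i, hi, hiS⟩ := hF.2.2 S hS.2.2 T hT (by omega)
  rw [Finset.mem_sdiff] at hi
  have := hmax (insert i S) ⟨hS.1.trans (Finset.subset_insert _ _),
    Finset.insert_subset (hTU hi.1) hS.2.1, hiS⟩
  rw [Finset.card_insert_of_notMem hi.2] at this
  omega

lemma rank_mono {M : Type} [Fintype M] [DecidableEq M] (F : Set (Finset M)) (hF : IsMatroid F)
    {U V : Finset M} (h : U ⊆ V) : rankFn F U ≤ rankFn F V := by
  obtain ⟨S, h1, h2, h3⟩ := rank_attain F hF U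
  rw [← h3]
  exact rank_ge F (h1.trans h) h2

lemma rank_submod {M : Type} [Fintype M] [DecidableEq M] (F : Set (Finset M)) (hF : IsMatroid F)
    (U V : Finset M) :
    rankFn F (U ∪ V) + rankFn F (U ∩ V) ≤ rankFn F U + rankFn F V := by
  obtain ⟨B, hB, hBF, hBc⟩ := rank_attain F hF (U ∩ V)
  obtain ⟨S, hBS, hSU, hSF, hSc⟩ := rank_extend F hF B (U ∪ V) hBF
    (hB.trans (Finset.inter_subset_left.trans Finset.subset_union_left))
  have h1 : (S ∩ U).card ≤ rankFn F U :=
    rank_ge F Finset.inter_subset_right (hF.2.1 _ S hSF Finset.inter_subset_left)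
  have h2 : (S ∩ V).card ≤ rankFn F V :=
    rank_ge F Finset.inter_subset_right (hF.2.1 _ S hSF Finset.inter_subset_left)
  have h3 := Finset.card_union_add_card_inter (S ∩ U) (S ∩ V)
  have h4 : S ∩ U ∪ S ∩ V = S := by
    rw [← Finset.inter_union_distrib_left]; exact Finset.inter_eq_left.2 hSU
  have h5 : B.card ≤ ((S ∩ U) ∩ (S ∩ V)).card := by
    apply Finset.card_le_card
    intro x hx
    have := hB hx
    have := hBS hx
    simp_all
  rw [h4] at h3
  omega

lemma rprime_submod {M K : Type} [Fintype M] [Fintype K] [DecidableEq M]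
    (F : Set (Finset M)) (hF : IsMatroid F) (Mk : K → Finset M) (d : K → ℕ) (U V : Finset M) :
    ∑ k : K, min (rankFn F ((U ∪ V) ∩ Mk k)) (d k) + ∑ k : K, min (rankFn F ((U ∩ V) ∩ Mk k)) (d k)
    ≤ ∑ k : K, min (rankFn F (U ∩ Mk k)) (d k) + ∑ k : K, min (rankFn F (V ∩ Mk k)) (d k) := by
  rw [← Finset.sum_add_distrib, ← Finset.sum_add_distrib]
  apply Finset.sum_le_sum
  intro k _
  have h := rank_submod F hF (U ∩ Mk k) (V ∩ Mk k)
  rw [← Finset.union_inter_distrib_right, ← Finset.inter_inter_distrib_right] at h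
  have h1 : rankFn F ((U ∩ V) ∩ Mk k) ≤ rankFn F (U ∩ Mk k) :=
    rank_mono F hF (by intro x hx; simp only [Finset.mem_inter, Finset.mem_union] at hx ⊢; tauto)
  have h2 : rankFn F ((U ∩ V) ∩ Mk k) ≤ rankFn F (V ∩ Mk k) :=
    rank_mono F hF (by intro x hx; simp only [Finset.mem_inter, Finset.mem_union] at hx ⊢; tauto)
  have h3 : rankFn F (U ∩ Mk k) ≤ rankFn F ((U ∪ V) ∩ Mk k) :=
    rank_mono F hF (by intro x hx; simp only [Finset.mem_inter, Finset.mem_union] at hx ⊢; tauto)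
  have h4 : rankFn F (V ∩ Mk k) ≤ rankFn F ((U ∪ V) ∩ Mk k) :=
    rank_mono F hF (by intro x hx; simp only [Finset.mem_inter, Finset.mem_union] at hx ⊢; tauto)
  omega

/-- The tight sets of a submodular system are unions of classes with integral mass. -/
lemma tight_classes {M : Type} [Fintype M] [DecidableEq M] (f : Finset M → ℕ) (h0 : f ∅ = 0)
    (hsub : ∀ U V, f (U ∪ V) + f (U ∩ V) ≤ f U + f V) (x : M → ℝ)
    (hx : ∀ U, ∑ i ∈ U, x i ≤ (f U : ℝ)) :
    ∃ P : Finset (Finset M), (∀ c ∈ P, ∀ c' ∈ P, c ≠ c' → Disjoint c c') ∧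
      (∀ c ∈ P, ∃ n : ℤ, ∑ i ∈ c, x i = n) ∧
      ∀ U, ∑ i ∈ U, x i = (f U : ℝ) → ∀ z : M → ℝ, (∀ c ∈ P, ∑ i ∈ c, z i = 0) →
        ∑ i ∈ U, z i = 0 := by
  set T : Finset M → Prop := fun U => ∑ i ∈ U, x i = (f U : ℝ) with hT
  have hboth : ∀ U V, T U → T V → T (U ∪ V) ∧ T (U ∩ V) := by
    intro U V hU hV
    have e := Finset.sum_union_inter (s₁ := U) (s₂ := V) (f := x)
    have s : ((f (U ∪ V) : ℝ) + f (U ∩ V)) ≤ f U + f V := by exact_mod_cast hsub U V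
    have a := hx (U ∪ V)
    have b := hx (U ∩ V)
    simp only [hT] at hU hV ⊢
    constructor <;> linarith
  have hTe : T ∅ := by simp [hT, h0]
  have hTU : ∀ s : Finset (Finset M), (∀ U ∈ s, T U) → T (s.sup id) := by
    intro s hs
    exact Finset.sup_induction hTe (fun a ha b hb => (hboth a b ha hb).1) hs
  -- minimal tight set containing a covered point
  have hmin : ∀ i, (∃ U, T U ∧ i ∈ U) → ∃ D, T D ∧ i ∈ D ∧ ∀ U, T U → i ∈ U → D ⊆ U := by
    rintro i ⟨U0, hU0, hi0⟩
    obtain ⟨D, hD, hm⟩ := Finset.exists_min_image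
      (Finset.univ.filter (fun U : Finset M => T U ∧ i ∈ U)) Finset.card ⟨U0, by simp [hU0, hi0]⟩
    simp only [Finset.mem_filter, Finset.mem_univ, true_and] at hD hm
    refine ⟨D, hD.1, hD.2, fun U hU hi => ?_⟩
    have h := hm (D ∩ U) ⟨(hboth D U hD.1 hU).2, by simp [hD.2, hi]⟩
    exact Finset.inter_eq_left.1 (Finset.eq_of_subset_of_card_le Finset.inter_subset_left h)
  choose! D hD1 hD2 hD3 using hmin
  set cov : Finset M := Finset.univ.filter (fun i => ∃ U, T U ∧ i ∈ U) with hcov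
  have mcov : ∀ i, i ∈ cov ↔ ∃ U, T U ∧ i ∈ U := by simp [hcov]
  set cl : M → Finset M := fun i => cov.filter (fun i' => D i' = D i) with hcl
  refine ⟨cov.image cl, ?_, ?_, ?_⟩
  · intro c hc c' hc' hne
    rw [Finset.mem_image] at hc hc'
    obtain ⟨a, ha, rfl⟩ := hc
    obtain ⟨b, hb, rfl⟩ := hc'
    rw [Finset.disjoint_left]
    intro i hi hi'
    simp only [hcl, Finset.mem_filter] at hi hi'
    apply hne
    simp only [hcl]
    rw [← hi.2, ← hi'.2]
  · intro c hc
    rw [Finset.mem_image] at hc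
    obtain ⟨a, ha, rfl⟩ := hc
    have ha' := (mcov a).1 ha
    set W : Finset M := ((D a).filter (fun i => D i ≠ D a)).image D |>.sup id with hW
    have hin : ∀ i ∈ D a, ∃ U, T U ∧ i ∈ U := fun i hi => ⟨D a, hD1 a ha', hi⟩
    have hWT : T W := by
      apply hTU
      intro U hU
      simp only [Finset.mem_image, Finset.mem_filter] at hU
      obtain ⟨i, hi, rfl⟩ := hU
      exact hD1 i (hin i hi.1)
    have mW : ∀ i, i ∈ W ↔ ∃ b ∈ D a, D b ≠ D a ∧ i ∈ D b := by
      intro i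
      simp [hW, Finset.mem_sup, and_assoc]
    have hWD : W ⊆ D a := by
      intro i hi
      obtain ⟨b, hb, -, hib⟩ := (mW i).1 hi
      exact hD3 b (hin b hb) _ (hD1 a ha') hb hib
    have hcW : cl a = D a \ W := by
      ext i
      simp only [hcl, Finset.mem_filter, Finset.mem_sdiff, mW]
      constructor
      · rintro ⟨h1, h2⟩
        have hi := hD2 i ((mcov i).1 h1)
        refine ⟨h2 ▸ hi, ?_⟩
        rintro ⟨b, hb, hne, hib⟩
        apply hne
        apply le_antisymm
        · exact hD3 b (hin b hb) _ (hD1 a ha') hb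
        · rw [← h2]
          exact hD3 i ((mcov i).1 h1) _ (hD1 b (hin b hb)) hib
      · rintro ⟨h1, h2⟩
        refine ⟨(mcov i).2 (hin i h1), ?_⟩
        by_contra hne
        exact h2 ⟨i, h1, hne, hD2 i (hin i h1)⟩
    refine ⟨(f (D a) : ℤ) - f W, ?_⟩
    rw [hcW]
    have e := Finset.sum_sdiff hWD (f := x)
    have e1 : T (D a) := hD1 a ha'
    simp only [hT] at e1 hWT
    push_cast
    linarith
  · intro U hU z hz
    have hUc : ∀ i ∈ U, ∃ U, T U ∧ i ∈ U := fun i hi => ⟨U, hU, hi⟩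
    rw [← Finset.sum_fiberwise_of_maps_to (t := U.image D) (g := D)
      (fun i hi => Finset.mem_image_of_mem D hi)]
    apply Finset.sum_eq_zero
    intro c hc
    rw [Finset.mem_image] at hc
    obtain ⟨a, ha, rfl⟩ := hc
    rw [← hz (cl a) (Finset.mem_image_of_mem _ ((mcov a).2 (hUc a ha)))]
    congr 1
    ext i
    simp only [hcl, Finset.mem_filter]
    constructor
    · rintro ⟨h1, h2⟩
      exact ⟨(mcov i).2 (hUc i h1), h2⟩
    · rintro ⟨h1, h2⟩
      refine ⟨hD3 a (hUc a ha) U hU ha ?_, h2⟩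
      rw [← h2]
      exact hD2 i ((mcov i).1 h1)

/-- A nonzero vector with vanishing sums on two families of disjoint sets of size at least two. -/
lemma exists_dir {E : Type} [Fintype E] [Nonempty E] [DecidableEq E] (R C : Finset (Finset E))
    (hR : ∀ c ∈ R, ∀ c' ∈ R, c ≠ c' → Disjoint c c')
    (hC : ∀ c ∈ C, ∀ c' ∈ C, c ≠ c' → Disjoint c c')
    (hR2 : ∀ c ∈ R, 2 ≤ c.card) (hC2 : ∀ c ∈ C, 2 ≤ c.card) :
    ∃ z : E → ℝ, z ≠ 0 ∧ (∀ c ∈ R, ∑ e ∈ c, z e = 0) ∧ (∀ c ∈ C, ∑ e ∈ c, z e = 0) := by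
  have key : ∀ R : Finset (Finset E), (∀ c ∈ R, ∀ c' ∈ R, c ≠ c' → Disjoint c c') →
      (∀ c ∈ R, 2 ≤ c.card) → 2 * R.card ≤ (R.biUnion id).card := by
    intro R hR hR2
    rw [Finset.card_biUnion (t := id) (fun x hx y hy h => hR x hx y hy h), mul_comm]
    exact Finset.card_nsmul_le_sum R _ 2 hR2
  have full : ∀ R : Finset (Finset E), (∀ c ∈ R, ∀ c' ∈ R, c ≠ c' → Disjoint c c') →
      (∀ c ∈ R, 2 ≤ c.card) → Fintype.card E ≤ 2 * R.card → ∀ z : E → ℝ,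
      ∑ c ∈ R, ∑ e ∈ c, z e = ∑ e, z e := by
    intro R hR hR2 hc z
    have : R.biUnion id = Finset.univ := by
      rw [← Finset.card_eq_iff_eq_univ]
      exact le_antisymm (Finset.card_le_univ _) (hc.trans (key R hR hR2))
    rw [← this, Finset.sum_biUnion (t := id) (fun x hx y hy h => hR x hx y hy h)]
    rfl
  have kR := (key R hR hR2).trans (Finset.card_le_univ _)
  have kC := (key C hC hC2).trans (Finset.card_le_univ _)
  have hpos : 0 < Fintype.card E := Fintype.card_pos
  let L : (E → ℝ) →ₗ[ℝ] ((R → ℝ) × (C → ℝ)) :=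
    { toFun := fun z => (fun c => ∑ e ∈ c.1, z e, fun c => ∑ e ∈ c.1, z e)
      map_add' := by
        intro a b
        ext <;> simp [Finset.sum_add_distrib]
      map_smul' := by
        intro a b
        ext <;> simp [Finset.mul_sum] }
  have hdim : Module.finrank ℝ ((R → ℝ) × (C → ℝ)) = R.card + C.card := by
    simp
  have hdimE : Module.finrank ℝ (E → ℝ) = Fintype.card E := by simp
  have hni : ¬ Function.Injective L := by
    intro hinj
    have h1 := LinearMap.finrank_le_finrank_of_injective hinj
    rw [hdim, hdimE] at h1
    have heq : Module.finrank ℝ (E → ℝ) = Module.finrank ℝ ((R → ℝ) × (C → ℝ)) := by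
      rw [hdim, hdimE]; omega
    have hsur := (LinearMap.injective_iff_surjective_of_finrank_eq_finrank heq).1 hinj
    obtain ⟨z, hz⟩ := hsur (fun _ => 1, fun _ => 0)
    have a1 : ∀ c ∈ R, ∑ e ∈ c, z e = 1 := fun c hc => congrFun (congrArg Prod.fst hz) ⟨c, hc⟩
    have a2 : ∀ c ∈ C, ∑ e ∈ c, z e = 0 := fun c hc => congrFun (congrArg Prod.snd hz) ⟨c, hc⟩
    have b1 := full R hR hR2 (by omega) z
    have b2 := full C hC hC2 (by omega) z
    rw [Finset.sum_congr rfl a1] at b1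
    rw [Finset.sum_congr rfl a2] at b2
    rw [← b2] at b1
    simp at b1
    subst b1
    simp at h1
    omega
  rw [← LinearMap.ker_eq_bot, Submodule.eq_bot_iff] at hni
  push Not at hni
  obtain ⟨z, hz, hz0⟩ := hni
  rw [LinearMap.mem_ker] at hz
  exact ⟨z, hz0, fun c hc => congrFun (congrArg Prod.fst hz) ⟨c, hc⟩,
    fun c hc => congrFun (congrArg Prod.snd hz) ⟨c, hc⟩⟩

lemma frac_card {α : Type} [DecidableEq α] (S : Finset α) (f : α → ℝ) (n : ℤ)
    (h : ∑ e ∈ S, f e = n)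
    (hne : (S.filter (fun e => ¬ ∃ m : ℤ, f e = m)).Nonempty) :
    2 ≤ (S.filter (fun e => ¬ ∃ m : ℤ, f e = m)).card := by
  by_contra hlt
  rw [not_le] at hlt
  have h1 : (S.filter (fun e => ¬ ∃ m : ℤ, f e = m)).card = 1 := by
    have := hne.card_pos
    omega
  obtain ⟨a, ha⟩ := Finset.card_eq_one.1 h1
  have hs := Finset.sum_filter_add_sum_filter_not S (fun e => ¬ ∃ m : ℤ, f e = m) f
  rw [ha, Finset.sum_singleton, h] at hs
  have hm : a ∈ S.filter (fun e => ¬ ∃ m : ℤ, f e = m) := by rw [ha]; simp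
  have hint : ∃ m : ℤ, ∑ e ∈ S.filter (fun e => ¬ ¬ ∃ m : ℤ, f e = m), f e = m := by
    have : ∀ e ∈ S.filter (fun e => ¬ ¬ ∃ m : ℤ, f e = m), f e = ((⌊f e⌋ : ℤ) : ℝ) := by
      intro e he
      simp only [Finset.mem_filter, not_not] at he
      obtain ⟨m, hm⟩ := he.2
      rw [hm]; simp
    refine ⟨∑ e ∈ S.filter (fun e => ¬ ¬ ∃ m : ℤ, f e = m), ⌊f e⌋, ?_⟩
    rw [Finset.sum_congr rfl this]
    push_cast
    rfl
  obtain ⟨m, hm'⟩ := hint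
  rw [hm'] at hs
  exact (Finset.mem_filter.1 hm).2 ⟨n - m, by push_cast; linarith⟩

lemma ev_slack (a b : ℝ) (ha : 0 ≤ a) (hab : a = 0 → b = 0) :
    ∀ᶠ s in nhds (0 : ℝ), 0 ≤ a + s * b := by
  rcases ha.eq_or_lt with h | h
  · rw [hab h.symm, ← h]; simp
  · have hc : Filter.Tendsto (fun s : ℝ => a + s * b) (nhds 0) (nhds (a + 0 * b)) :=
      Continuous.tendsto (by fun_prop) 0
    simp only [zero_mul, add_zero] at hc
    exact (hc.eventually (lt_mem_nhds h)).mono (fun s hs => hs.le)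

/-- First part of Lemma 10: every extreme point of the polytope `P` is integral. -/
theorem lemma10_integrality (M J K : Type) [Fintype M] [Fintype J] [Fintype K]
    [DecidableEq M]
    (F : J → Set (Finset M)) (hF : ∀ j, IsMatroid (F j))
    (Mk : J → K → Finset M)
    (hdisj : ∀ (j : J) (k k' : K), k ≠ k' → Disjoint (Mk j k) (Mk j k'))
    (d : J → K → ℕ)
    (y : M → J → ℝ) (hy : memP F Mk d y)
    (hext : ∀ y₁ y₂ : M → J → ℝ, memP F Mk d y₁ → memP F Mk d y₂ →
      ∀ t : ℝ, 0 < t → t < 1 →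
        (∀ (i : M) (j : J), y i j = t * y₁ i j + (1 - t) * y₂ i j) → y₁ = y₂) :
    ∀ (i : M) (j : J), ∃ n : ℤ, y i j = (n : ℝ) := by
  by_contra hcon
  push Not at hcon
  obtain ⟨i0, j0, h0⟩ := hcon
  obtain ⟨hy1, hy2, hy3⟩ := hy
  have hcl := fun j => tight_classes
    (fun U => ∑ k : K, min (rankFn (F j) (U ∩ Mk j k)) (d j k))
    (by simp [rankFn, Finset.subset_empty])
    (rprime_submod (F j) (hF j) (Mk j) (d j)) (fun i => y i j) (hy3 j)
  choose P hP1 hP2 hP3 using hcl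
  let yy : M × J → ℝ := fun p => y p.1 p.2
  let E := {p : M × J // ¬ ∃ m : ℤ, yy p = m}
  have : Nonempty E := ⟨⟨(i0, j0), by rintro ⟨m, hm⟩; exact h0 m hm⟩⟩
  -- trace of a set on the fractional entries
  let tr : Finset (M × J) → Finset E := fun S => Finset.univ.filter (fun e => e.1 ∈ S)
  have mtr : ∀ S e, e ∈ tr S ↔ e.1 ∈ S := by intro S e; simp [tr]
  have trmap : ∀ S, (tr S).map (Function.Embedding.subtype _) =
      S.filter (fun e => ¬ ∃ m : ℤ, yy e = m) := by
    intro S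
    ext p
    simp only [Finset.mem_map, mtr, Finset.mem_filter]
    constructor
    · rintro ⟨e, he, rfl⟩
      exact ⟨he, e.2⟩
    · rintro ⟨h1, h2⟩
      exact ⟨⟨p, h2⟩, h1, rfl⟩
  have tr2 : ∀ S, (∃ n : ℤ, ∑ p ∈ S, yy p = n) → (tr S).Nonempty → 2 ≤ (tr S).card := by
    rintro S ⟨n, hn⟩ hne
    rw [← Finset.card_map (Function.Embedding.subtype _), trmap]
    apply frac_card S yy n hn
    rw [← trmap]
    exact hne.map
  have trdisj : ∀ S S', Disjoint S S' → Disjoint (tr S) (tr S') := by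
    intro S S' h
    rw [Finset.disjoint_left] at h ⊢
    intro e
    rw [mtr, mtr]
    exact fun a => h a
  let rowS : M → Finset (M × J) := fun i => {i} ×ˢ Finset.univ
  let colS : J → Finset M → Finset (M × J) := fun j c => c ×ˢ {j}
  let R : Finset (Finset E) := ((Finset.univ.filter (fun i => ∑ j, y i j = 26)).image
    (fun i => tr (rowS i))).filter Finset.Nonempty
  let C : Finset (Finset E) := (Finset.univ.biUnion (fun j => (P j).image
    (fun c => tr (colS j c)))).filter Finset.Nonempty
  have mR : ∀ c, c ∈ R ↔ (∃ i, ∑ j, y i j = 26 ∧ tr (rowS i) = c) ∧ c.Nonempty := by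
    intro c; simp [R]
  have mC : ∀ c, c ∈ C ↔ (∃ j, ∃ b ∈ P j, tr (colS j b) = c) ∧ c.Nonempty := by
    intro c; simp [C]
  have rowsum : ∀ (x : M × J → ℝ) i, ∑ p ∈ rowS i, x p = ∑ j, x (i, j) := by
    intro x i; simp [rowS]
  have colsum : ∀ (x : M × J → ℝ) j c, ∑ p ∈ colS j c, x p = ∑ i ∈ c, x (i, j) := by
    intro x j c; simp [colS]
  obtain ⟨z, hz0, hzR, hzC⟩ := exists_dir R C
    (by
      intro c hc c' hc' hne
      obtain ⟨⟨i, hi, rfl⟩, -⟩ := (mR c).1 hc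
      obtain ⟨⟨i', hi', rfl⟩, -⟩ := (mR c').1 hc'
      apply trdisj
      rw [Finset.disjoint_left]
      rintro ⟨a, b⟩ h1 h2
      simp [rowS] at h1 h2
      subst h1; subst h2
      exact hne rfl)
    (by
      intro c hc c' hc' hne
      obtain ⟨⟨j, b, hb, rfl⟩, -⟩ := (mC c).1 hc
      obtain ⟨⟨j', b', hb', rfl⟩, -⟩ := (mC c').1 hc'
      apply trdisj
      rw [Finset.disjoint_left]
      rintro ⟨u, v⟩ h1 h2
      simp [colS] at h1 h2
      obtain ⟨h1, rfl⟩ := h1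
      obtain ⟨h2, rfl⟩ := h2
      have hbb : b ≠ b' := by rintro rfl; exact hne rfl
      exact Finset.disjoint_left.1 (hP1 _ b hb b' hb' hbb) h1 h2)
    (by
      intro c hc
      obtain ⟨⟨i, hi, rfl⟩, hn⟩ := (mR c).1 hc
      refine tr2 _ ⟨26, ?_⟩ hn
      rw [rowsum]
      simpa [yy] using hi)
    (by
      intro c hc
      obtain ⟨⟨j, b, hb, rfl⟩, hn⟩ := (mC c).1 hc
      refine tr2 _ ?_ hn
      rw [colsum]
      exact hP2 j b hb)
  let zz : M × J → ℝ := fun p => if h : ¬ ∃ m : ℤ, yy p = m then z ⟨p, h⟩ else 0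
  have zzE : ∀ e : E, zz e.1 = z e := by
    intro e
    simp only [zz]
    rw [dif_pos e.2]
  have zz0 : ∀ p, (∃ m : ℤ, yy p = m) → zz p = 0 := by
    intro p hp
    simp only [zz]
    rw [dif_neg (not_not.2 hp)]
  have sumtr : ∀ S, ∑ p ∈ S, zz p = ∑ e ∈ tr S, z e := by
    intro S
    have e1 : ∑ e ∈ tr S, z e = ∑ p ∈ S.filter (fun e => ¬ ∃ m : ℤ, yy e = m), zz p := by
      rw [← trmap, Finset.sum_map]
      exact Finset.sum_congr rfl (fun e _ => (zzE e).symm)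
    rw [e1]
    symm
    apply Finset.sum_subset (Finset.filter_subset _ _)
    intro p hp hnp
    apply zz0
    by_contra hh
    exact hnp (Finset.mem_filter.2 ⟨hp, hh⟩)
  have zrow : ∀ i, ∑ j, y i j = 26 → ∑ j, zz (i, j) = 0 := by
    intro i hi
    rw [← rowsum, sumtr]
    rcases (tr (rowS i)).eq_empty_or_nonempty with h | h
    · rw [h]; simp
    · exact hzR _ ((mR _).2 ⟨⟨i, hi, rfl⟩, h⟩)
  have zcol : ∀ j, ∀ c ∈ P j, ∑ i ∈ c, zz (i, j) = 0 := by
    intro j c hc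
    rw [← colsum, sumtr]
    rcases (tr (colS j c)).eq_empty_or_nonempty with h | h
    · rw [h]; simp
    · exact hzC _ ((mC _).2 ⟨⟨j, c, hc, rfl⟩, h⟩)
  have hev : ∀ᶠ s in nhds (0 : ℝ), memP F Mk d (fun i j => y i j + s * zz (i, j)) := by
    have A1 : ∀ᶠ s in nhds (0 : ℝ), ∀ i j, 0 ≤ y i j + s * zz (i, j) := by
      simp only [Filter.eventually_all]
      intro i j
      exact ev_slack _ _ (hy1 i j) (fun h => zz0 _ ⟨0, by simpa [yy] using h⟩)
    have A2 : ∀ᶠ s in nhds (0 : ℝ), ∀ i, 0 ≤ (26 - ∑ j, y i j) + s * (- ∑ j, zz (i, j)) := by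
      simp only [Filter.eventually_all]
      intro i
      refine ev_slack _ _ (sub_nonneg.2 (hy2 i)) (fun h => ?_)
      rw [zrow i (by linarith)]; simp
    have A3 : ∀ᶠ s in nhds (0 : ℝ), ∀ j U,
        0 ≤ (((∑ k : K, min (rankFn (F j) (U ∩ Mk j k)) (d j k) : ℕ) : ℝ) - ∑ i ∈ U, y i j)
          + s * (- ∑ i ∈ U, zz (i, j)) := by
      simp only [Filter.eventually_all]
      intro j U
      refine ev_slack _ _ (sub_nonneg.2 (hy3 j U)) (fun h => ?_)
      rw [hP3 j U (by linarith) (fun i => zz (i, j)) (zcol j)]; simp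
    filter_upwards [A1, A2, A3] with s h1 h2 h3
    refine ⟨h1, fun i => ?_, fun j U => ?_⟩
    · rw [Finset.sum_add_distrib, ← Finset.mul_sum]
      linarith [h2 i]
    · rw [Finset.sum_add_distrib, ← Finset.mul_sum]
      linarith [h3 j U]
  obtain ⟨ε, hε, hball⟩ := Metric.eventually_nhds_iff.1 hev
  have m1 := hball (y := ε / 2) (by rw [Real.dist_eq, sub_zero, abs_of_pos] <;> linarith)
  have m2 := hball (y := -(ε / 2))
    (by rw [Real.dist_eq, sub_zero, abs_neg, abs_of_pos] <;> linarith)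
  have heq := hext _ _ m1 m2 (1 / 2) (by norm_num) (by norm_num) (fun i j => by ring)
  apply hz0
  funext e
  have h := congrFun (congrFun heq e.1.1) e.1.2
  have h2 := zzE e
  simp only [Prod.mk.eta] at h
  rw [h2] at h
  have : ε * z e = 0 := by linarith
  simpa [hε.ne'] using this
end

section
/- Let M and J_3 be finite sets, for each j ∈ J_3 let F_j be a matroid on M with rank function r_j, let K be a finite index set and (M_{jk})_{k∈K} pairwise disjoint subsets of M for each j. Let x' : 2^M × J_3 → ℝ_{≥0} satisfy: Σ_{S⊆M} x'(S,j) ≤ 1 for each j ∈ J_3; x'(S,j) > 0 implies S ∈ F_j; and, writing x'_{ij} := Σ_{S∋i} x'(S,j), Σ_{j∈J_3} x'_{ij} ≤ 26 for each i ∈ M. Set d_{jk} := ⌊Σ_{i∈M_{jk}} x'_{ij}⌋ and r'_j(U) := Σ_{k∈K} min{r_j(U ∩ M_{jk}), d_{jk}}. Then there exists y ∈ ℝ_{≥0}^{M×J_3} with Σ_{j∈J_3} y_{ij} ≤ 26 for all i ∈ M, Σ_{i∈U} y_{ij} ≤ r'_j(U) for all U ⊆ M and j ∈ J_3, and Σ_{i∈M}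 Σ_{j∈J_3} y_{ij} = Σ_{j∈J_3} Σ_{k∈K} d_{jk}. (Lemma 11.) -/
open Finset
open scoped Classical

/-- `d_{jk} = ⌊∑_{i ∈ M_{jk}} x'_{ij}⌋` where `x'_{ij} = ∑_{S ∋ i} x'(S,j)`. -/
noncomputable def djk {M J K : Type} [Fintype M] (Mk : J → K → Finset M)
    (x' : Finset M → J → ℝ) (j : J) (k : K) : ℕ :=
  ⌊∑ i ∈ Mk j k, ∑ S ∈ Finset.univ.filter (fun S : Finset M => i ∈ S), x' S j⌋₊

/-- Lemma 11: the polymatroid intersection LP has a feasible solution of value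
`∑_j ∑_k d_{jk}`. -/
theorem lemma11_pmi_value (M J K : Type) [Fintype M] [Fintype J] [Fintype K]
    [DecidableEq M]
    (F : J → Set (Finset M)) (hF : ∀ j, IsMatroid (F j))
    (Mk : J → K → Finset M)
    (hdisj : ∀ (j : J) (k k' : K), k ≠ k' → Disjoint (Mk j k) (Mk j k'))
    (x' : Finset M → J → ℝ)
    (hx0 : ∀ (S : Finset M) (j : J), 0 ≤ x' S j)
    (hx1 : ∀ j : J, ∑ S : Finset M, x' S j ≤ 1)
    (hxF : ∀ (S : Finset M) (j : J), 0 < x' S j → S ∈ F j)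
    (hx26 : ∀ i : M,
      ∑ j : J, (∑ S ∈ Finset.univ.filter (fun S : Finset M => i ∈ S), x' S j) ≤ 26) :
    ∃ y : M → J → ℝ,
      (∀ (i : M) (j : J), 0 ≤ y i j) ∧
      (∀ i : M, ∑ j : J, y i j ≤ 26) ∧
      (∀ (j : J) (U : Finset M),
        ∑ i ∈ U, y i j ≤
          ((∑ k : K, min (rankFn (F j) (U ∩ Mk j k)) (djk Mk x' j k) : ℕ) : ℝ)) ∧
      (∑ i : M, ∑ j : J, y i j) = ∑ j : J, ∑ k : K, ((djk Mk x' j k : ℕ) : ℝ) := by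
  obtain ⟨X, hX⟩ : ∃ X : M → J → ℝ, X = fun i j =>
      ∑ S ∈ Finset.univ.filter (fun S : Finset M => i ∈ S), x' S j := ⟨_, rfl⟩
  have hX0 : ∀ i j, 0 ≤ X i j := by
    intro i j
    rw [hX]
    exact Finset.sum_nonneg fun S _ => hx0 S j
  have hX26 : ∀ i, ∑ j, X i j ≤ 26 := by
    intro i
    rw [hX]
    exact hx26 i
  have hd : ∀ j k, djk Mk x' j k = ⌊∑ i ∈ Mk j k, X i j⌋₊ := by
    intro j k
    rw [hX]
    unfold djk
    congr!
  have hs0 : ∀ j k, 0 ≤ ∑ i ∈ Mk j k, X i j := fun j k =>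
    Finset.sum_nonneg fun i _ => hX0 i j
  have hds : ∀ j k, ((djk Mk x' j k : ℕ) : ℝ) ≤ ∑ i ∈ Mk j k, X i j := by
    intro j k
    rw [hd]
    exact Nat.floor_le (hs0 j k)
  obtain ⟨c, hc⟩ : ∃ c : J → K → ℝ, c = fun j k =>
      ((djk Mk x' j k : ℕ) : ℝ) / ∑ i ∈ Mk j k, X i j := ⟨_, rfl⟩
  have hc0 : ∀ j k, 0 ≤ c j k := by
    intro j k
    rw [hc]
    exact div_nonneg (Nat.cast_nonneg _) (hs0 j k)
  have hc1 : ∀ j k, c j k ≤ 1 := by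
    intro j k
    rw [hc]
    exact div_le_one_of_le₀ (hds j k) (hs0 j k)
  have hcs : ∀ j k, (∑ i ∈ Mk j k, X i j) * c j k = ((djk Mk x' j k : ℕ) : ℝ) := by
    intro j k
    rw [hc]
    by_cases h : ∑ i ∈ Mk j k, X i j = 0
    · have h1 := hds j k
      rw [h] at h1
      have h2 : (0 : ℝ) ≤ ((djk Mk x' j k : ℕ) : ℝ) := Nat.cast_nonneg _
      rw [h]
      linarith
    · exact mul_div_cancel₀ _ h
  have hrank : ∀ (j : J) (V : Finset M), ∑ i ∈ V, X i j ≤ (rankFn (F j) V : ℝ) := by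
    intro j V
    have h1 : ∑ i ∈ V, X i j = ∑ S : Finset M, ((V ∩ S).card : ℝ) * x' S j := by
      rw [hX]
      simp only [Finset.sum_filter]
      rw [Finset.sum_comm]
      refine Finset.sum_congr rfl fun S _ => ?_
      rw [← Finset.sum_filter, Finset.sum_const, nsmul_eq_mul, Finset.filter_mem_eq_inter]
    rw [h1]
    calc ∑ S : Finset M, ((V ∩ S).card : ℝ) * x' S j
        ≤ ∑ S : Finset M, (rankFn (F j) V : ℝ) * x' S j := by
          refine Finset.sum_le_sum fun S _ => ?_
          rcases (hx0 S j).eq_or_lt with h | h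
          · rw [← h]; simp
          · refine mul_le_mul_of_nonneg_right ?_ h.le
            have hm : V ∩ S ∈ F j :=
              (hF j).2.1 _ _ (hxF S j h) Finset.inter_subset_right
            have : (V ∩ S).card ≤ rankFn (F j) V := by
              unfold rankFn
              refine Finset.le_sup (f := Finset.card) ?_
              simp only [Finset.mem_filter, Finset.mem_univ, true_and]
              exact ⟨Finset.inter_subset_left, hm⟩
            exact_mod_cast this
      _ = (rankFn (F j) V : ℝ) * ∑ S : Finset M, x' S j := by rw [Finset.mul_sum]
      _ ≤ (rankFn (F j) V : ℝ) :=
          mul_le_of_le_one_right (Nat.cast_nonneg _) (hx1 j)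
  have hsum : ∀ (j : J) (U : Finset M),
      ∑ i ∈ U, ∑ k, (if i ∈ Mk j k then X i j * c j k else 0)
        = ∑ k, (∑ i ∈ U ∩ Mk j k, X i j) * c j k := by
    intro j U
    rw [Finset.sum_comm]
    refine Finset.sum_congr rfl fun k _ => ?_
    rw [← Finset.sum_filter, Finset.filter_mem_eq_inter, Finset.sum_mul]
  refine ⟨fun i j => ∑ k, (if i ∈ Mk j k then X i j * c j k else 0), ?_, ?_, ?_, ?_⟩
  · intro i j
    refine Finset.sum_nonneg fun k _ => ?_
    split_ifs
    · exact mul_nonneg (hX0 i j) (hc0 j k)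
    · exact le_rfl
  · intro i
    refine le_trans (Finset.sum_le_sum fun j _ => ?_) (hX26 i)
    beta_reduce
    by_cases h : ∃ k, i ∈ Mk j k
    · obtain ⟨k, hk⟩ := h
      rw [Finset.sum_eq_single k]
      · rw [if_pos hk]
        exact mul_le_of_le_one_right (hX0 i j) (hc1 j k)
      · intro k' _ hne
        rw [if_neg]
        intro hk'
        exact (Finset.disjoint_left.1 (hdisj j k' k hne)) hk' hk
      · intro h
        exact absurd (Finset.mem_univ _) h
    · push Not at h
      rw [Finset.sum_eq_zero]
      · exact hX0 i j
      · intro k _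
        rw [if_neg (h k)]
  · intro j U
    rw [hsum]
    push_cast
    refine Finset.sum_le_sum fun k _ => le_min ?_ ?_
    · refine le_trans (mul_le_of_le_one_right ?_ (hc1 j k)) (hrank j _)
      exact Finset.sum_nonneg fun i _ => hX0 i j
    · rw [← hcs j k]
      refine mul_le_mul_of_nonneg_right ?_ (hc0 j k)
      exact Finset.sum_le_sum_of_subset_of_nonneg Finset.inter_subset_right
        fun i _ _ => hX0 i j
  · rw [Finset.sum_comm]
    refine Finset.sum_congr rfl fun j _ => ?_
    rw [hsum]
    refine Finset.sum_congr rfl fun k _ => ?_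
    rw [Finset.univ_inter, hcs]
end

section
/- Let M be a finite set, C > 0, x : M → ℝ_{≥0}, and w : M → ℝ with w_i > 0 for all i ∈ M and w_i < 1/(8C) for every i with x_i > 0, and suppose Σ_{i∈M} w_i·x_i ≥ 79/(40C). For k ∈ ℕ define M_k := {i ∈ M : 1/(2^{k+1}·C) < w_i ≤ 1/(2^k·C)} and d_k := ⌊Σ_{i∈M_k} x_i⌋. Then Σ_{k≥3} d_k/(2^k·C) ≥ 69/(40C). (Lemma 12, with x_i = x'_{ij} and w_i = μ_i/λ_j.) -/
open Finset
open scoped Classical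

/-- Lemma 12: let `C > 0`, `x ≥ 0` and `w > 0` with `w_i < 1/(8C)` whenever `x_i > 0`,
and `∑_i w_i x_i ≥ 79/(40C)`. With `M_k = {i : 1/(2^{k+1} C) < w_i ≤ 1/(2^k C)}` and
`d_k = ⌊∑_{i ∈ M_k} x_i⌋`, we have `∑_{k ≥ 3} d_k / (2^k C) ≥ 69/(40C)`. -/
theorem lemma12_speed_sum (M : Type) [Fintype M] (C : ℝ) (hC : 0 < C)
    (x w : M → ℝ)
    (hx : ∀ i, 0 ≤ x i) (hw : ∀ i, 0 < w i)
    (hwx : ∀ i, 0 < x i → w i < 1 / (8 * C))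
    (hsum : 79 / (40 * C) ≤ ∑ i : M, w i * x i) :
    69 / (40 * C) ≤
      ∑' k : ℕ, if 3 ≤ k then
        ((⌊∑ i ∈ Finset.univ.filter
            (fun i => 1 / (2 ^ (k + 1) * C) < w i ∧ w i ≤ 1 / (2 ^ k * C)), x i⌋₊ : ℝ) /
          (2 ^ k * C))
      else 0 := by
  have hanti : ∀ m n : ℕ, m ≤ n → 1 / ((2:ℝ) ^ n * C) ≤ 1 / (2 ^ m * C) := by
    intro m n h
    have : (2:ℝ) ^ m ≤ 2 ^ n := pow_le_pow_right₀ (by norm_num) h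
    exact one_div_le_one_div_of_le (by positivity) (by nlinarith)
  have hN0 : ∀ i, ∃ n : ℕ, 1 / ((2:ℝ) ^ n * C) < w i := by
    intro i
    obtain ⟨n, hn⟩ := exists_pow_lt_of_lt_one (mul_pos (hw i) hC)
      (show (1 / 2 : ℝ) < 1 by norm_num)
    refine ⟨n, ?_⟩
    rw [← div_div, div_lt_iff₀ hC]
    simpa using hn
  choose f hf using hN0
  obtain ⟨N, hN⟩ : ∃ N : ℕ, ∀ i, 1 / ((2:ℝ) ^ N * C) < w i :=
    ⟨Finset.univ.sup f, fun i =>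
      lt_of_le_of_lt (hanti _ _ (Finset.le_sup (Finset.mem_univ i))) (hf i)⟩
  have hgeo : ∀ n : ℕ, ∑ k ∈ Finset.range n, (if 3 ≤ k then 1 / ((2:ℝ) ^ k * C) else 0)
      ≤ 10 / (40 * C) := by
    intro n
    have key : ∀ m : ℕ, ∑ k ∈ Finset.range (m + 3),
        (if 3 ≤ k then 1 / ((2:ℝ) ^ k * C) else 0) = (1 / 4 - 1 / 2 ^ (m + 2)) / C := by
      intro m
      induction m with
      | zero => norm_num [Finset.sum_range_succ]
      | succ m ih =>
        rw [show m + 1 + 3 = (m + 3) + 1 by ring, Finset.sum_range_succ, ih, if_pos (by omega)]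
        field_simp
        ring
    calc _ ≤ ∑ k ∈ Finset.range (n + 3), (if 3 ≤ k then 1 / ((2:ℝ) ^ k * C) else 0) := by
          apply Finset.sum_le_sum_of_subset_of_nonneg
          · exact Finset.range_mono (by omega)
          · intro k _ _
            split_ifs <;> positivity
      _ = (1 / 4 - 1 / 2 ^ (n + 2)) / C := key n
      _ ≤ (1 / 4) / C := by
          apply div_le_div_of_nonneg_right _ hC.le
          have : (0:ℝ) < 1 / 2 ^ (n + 2) := by positivity
          linarith
      _ = 10 / (40 * C) := by
          field_simp
          norm_num
  rw [tsum_eq_sum (s := Finset.range N)]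
  · have hpt : ∀ i, w i * x i ≤ ∑ k ∈ Finset.range N, (if 3 ≤ k then
        (if (1 / (2 ^ (k + 1) * C) < w i ∧ w i ≤ 1 / (2 ^ k * C)) then x i else 0) / (2 ^ k * C)
        else 0) := by
      intro i
      have hnn : ∀ k ∈ Finset.range N, 0 ≤ (if 3 ≤ k then
        (if (1 / (2 ^ (k + 1) * C) < w i ∧ w i ≤ 1 / (2 ^ k * C)) then x i else 0) / (2 ^ k * C)
        else 0) := by
        intro k _
        have := hx i
        split_ifs <;> positivity
      rcases (hx i).eq_or_lt with h0 | h0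
      · rw [← h0, mul_zero]
        rw [← h0] at hnn
        exact Finset.sum_nonneg hnn
      · have h8 := hwx i h0
        have hex : ∃ n : ℕ, 1 / ((2:ℝ) ^ n * C) < w i := ⟨N, hN i⟩
        have hs := Nat.find_spec hex
        have hm : ∀ m, m < Nat.find hex → _ := fun m h => Nat.find_min hex h
        have hle : Nat.find hex ≤ N := Nat.find_min' hex (hN i)
        generalize Nat.find hex = p at hs hm hle
        have h3 : 3 < p := by
          by_contra! h
          have := hanti p 3 h
          norm_num at this h8 hs
          linarith
        obtain ⟨k, rfl⟩ : ∃ k, p = k + 1 := ⟨p - 1, by omega⟩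
        have hk := not_lt.mp (hm k (by omega))
        refine le_trans ?_ (Finset.single_le_sum hnn (Finset.mem_range.mpr (show k < N by omega)))
        rw [if_pos (by omega), if_pos ⟨hs, hk⟩]
        calc w i * x i ≤ 1 / (2 ^ k * C) * x i := mul_le_mul_of_nonneg_right hk h0.le
          _ = _ := by ring
    have h1 := Finset.sum_le_sum (fun i (_ : i ∈ (Finset.univ : Finset M)) => hpt i)
    rw [Finset.sum_comm] at h1
    have h2 : ∀ k ∈ Finset.range N, (∑ i : M, (if 3 ≤ k then
        (if (1 / (2 ^ (k + 1) * C) < w i ∧ w i ≤ 1 / (2 ^ k * C)) then x i else 0) / (2 ^ k * C)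
        else 0)) ≤ (if 3 ≤ k then
        ((⌊∑ i ∈ Finset.univ.filter
            (fun i => 1 / (2 ^ (k + 1) * C) < w i ∧ w i ≤ 1 / (2 ^ k * C)), x i⌋₊ : ℝ) /
          (2 ^ k * C))
        else 0) + (if 3 ≤ k then 1 / ((2:ℝ) ^ k * C) else 0) := by
      intro k _
      split_ifs with h
      · rw [← Finset.sum_div, ← Finset.sum_filter, ← add_div]
        apply div_le_div_of_nonneg_right _ (by positivity)
        exact (Nat.lt_floor_add_one _).le
      · simp
    have h3 := Finset.sum_le_sum h2
    rw [Finset.sum_add_distrib] at h3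
    have h4 := hgeo N
    have h5 : 79 / (40 * C) = 69 / (40 * C) + 10 / (40 * C) := by
      rw [← add_div]
      norm_num
    linarith
  · intro k hk
    have hk' : N ≤ k := by simpa using hk
    rw [Finset.filter_false_of_mem]
    · simp
    · rintro i _ ⟨_, h⟩
      exact absurd (hN i) (not_lt.mpr (h.trans (hanti _ _ hk')))
end

section
/- Let F be a matroid on a finite set M with rank function r, let C > 0, let (M_k)_{k∈ℕ} be pairwise disjoint subsets of M, and let w : M → ℝ satisfy 1/(2^{k+1}·C) < w_i ≤ 1/(2^k·C) for every k ∈ ℕ and i ∈ M_k. Let S ⊆ ∪_{k∈ℕ} M_k and let T be a maximum-weight set in {T' ⊆ S : T' ∈ F} with respect to the weights w. Then Σ_{i∈T} w_i ≥ (1/2)·Σ_{k∈ℕ} r(S ∩ M_k)/(2^{k+1}·C). (Greedy bound used in the proof of Lemma 13.) -/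
open Finset
open scoped Classical

theorem matroid_extend {M : Type} [DecidableEq M] (F : Set (Finset M)) (hF : IsMatroid F)
    (T : Finset M) (hT : T ∈ F) (n : ℕ) : ∀ A : Finset M, A ∈ F → A.card + n = T.card →
      ∃ A' ∈ F, A ⊆ A' ∧ A' ⊆ A ∪ T ∧ A'.card = T.card := by
  induction n with
  | zero => intro A hA hc; exact ⟨A, hA, Subset.refl _, subset_union_left, by simpa using hc⟩
  | succ n ih =>
    intro A hA hc
    obtain ⟨i, hi, hiF⟩ := hF.2.2 A hA T hT (by omega)
    rw [mem_sdiff] at hi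
    obtain ⟨A', h1, h2, h3, h4⟩ := ih (insert i A) hiF (by rw [card_insert_of_notMem hi.2]; omega)
    refine ⟨A', h1, (subset_insert _ _).trans h2, ?_, h4⟩
    intro x hx
    have := h3 hx
    simp only [mem_union, mem_insert] at this ⊢
    rcases this with (rfl | h) | h
    · exact Or.inr hi.1
    · exact Or.inl h
    · exact Or.inr h

theorem card_bound {M : Type} [DecidableEq M] (F : Set (Finset M)) (hF : IsMatroid F)
    (w : M → ℝ) (S T : Finset M) (hTS : T ⊆ S) (hTF : T ∈ F)
    (hTmax : ∀ T' : Finset M, T' ⊆ S → T' ∈ F → ∑ i ∈ T', w i ≤ ∑ i ∈ T, w i)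
    (A B : Finset M) (hA : A ⊆ T) (hB : B ⊆ S) (hBF : B ∈ F) (hBT : ∀ i ∈ B, i ∈ T → i ∈ A)
    (hpos : ∀ i ∈ B, 0 < w i) (hlt : ∀ i ∈ B, ∀ j ∈ T, j ∉ A → w j < w i) :
    B.card ≤ A.card := by
  by_contra! hcon
  obtain ⟨i, hi, hiF⟩ := hF.2.2 A (hF.2.1 _ _ hTF hA) B hBF hcon
  rw [mem_sdiff] at hi
  have hiT : i ∉ T := fun h => hi.2 (hBT i hi.1 h)
  by_cases hAT : A = T
  · subst hAT
    have := hTmax _ (insert_subset (hB hi.1) hTS) hiF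
    rw [sum_insert hi.2] at this
    linarith [hpos i hi.1]
  · have hc : A.card < T.card := card_lt_card (hA.ssubset_of_ne hAT)
    have hci : (insert i A).card = A.card + 1 := card_insert_of_notMem hi.2
    obtain ⟨T', h1, h2, h3, h4⟩ := matroid_extend F hF T hTF (T.card - (A.card + 1))
      (insert i A) hiF (by omega)
    have hsub : T' ⊆ insert i T := by
      intro x hx
      have := h3 hx
      simp only [mem_union, mem_insert] at this ⊢
      rcases this with (h | h) | h
      · exact Or.inl h
      · exact Or.inr (hA h)
      · exact Or.inr h
    have hiT' : i ∈ T' := h2 (mem_insert_self _ _)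
    have hle := hTmax T' (hsub.trans (insert_subset (hB hi.1) hTS)) h1
    have hcard : (insert i T \ T').card = 1 := by
      rw [card_sdiff_of_subset hsub, card_insert_of_notMem hiT]; omega
    obtain ⟨j, hj⟩ := card_eq_one.mp hcard
    have hs := sum_sdiff (f := w) hsub
    rw [hj, sum_singleton, sum_insert hiT] at hs
    have hjm : j ∈ insert i T \ T' := by rw [hj]; exact mem_singleton_self _
    rw [mem_sdiff, mem_insert] at hjm
    have hjT : j ∈ T := by
      rcases hjm.1 with h | h
      · exact absurd (h ▸ hiT') hjm.2
      · exact h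
    have := hlt i hi.1 j hjT (fun h => hjm.2 (h2 (mem_insert_of_mem h)))
    linarith

theorem hasSum_tail (C : ℝ) (m : ℕ) :
    HasSum (fun k : ℕ => if m ≤ k then 1 / (2 ^ (k + 1) * C) else 0) (1 / (2 ^ m * C)) := by
  have hinj : Function.Injective (fun n : ℕ => n + m) := add_left_injective m
  rw [← hinj.hasSum_iff]
  · convert hasSum_geometric_two' (1 / (2 ^ m * C)) using 1
    funext n
    simp only [Function.comp, Nat.le_add_left, if_true, pow_add, pow_one, div_div]
    congr 1
    ring
  · intro k hk
    rw [if_neg]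
    intro h
    exact hk ⟨k - m, by simp [h]⟩

/-- Greedy bound used in the proof of Lemma 13: if the disjoint sets `M_k` consist of
elements of weight in `(1/(2^{k+1} C), 1/(2^k C)]`, `S ⊆ ∪_k M_k`, and `T` is a
maximum-weight independent subset of `S`, then
`∑_{i ∈ T} w_i ≥ (1/2) ∑_k r(S ∩ M_k) / (2^{k+1} C)`. -/
theorem greedy_weight_bound (M : Type) [Fintype M] [DecidableEq M]
    (F : Set (Finset M)) (hF : IsMatroid F)
    (C : ℝ) (hC : 0 < C)
    (Mk : ℕ → Finset M)
    (hdisj : ∀ k k' : ℕ, k ≠ k' → Disjoint (Mk k) (Mk k'))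
    (w : M → ℝ)
    (hw : ∀ k : ℕ, ∀ i ∈ Mk k, 1 / (2 ^ (k + 1) * C) < w i ∧ w i ≤ 1 / (2 ^ k * C))
    (S : Finset M) (hS : ∀ i ∈ S, ∃ k : ℕ, i ∈ Mk k)
    (T : Finset M) (hTS : T ⊆ S) (hTF : T ∈ F)
    (hTmax : ∀ T' : Finset M, T' ⊆ S → T' ∈ F → ∑ i ∈ T', w i ≤ ∑ i ∈ T, w i) :
    (1 / 2) * ∑' k : ℕ, (rankFn F (S ∩ Mk k) : ℝ) / (2 ^ (k + 1) * C) ≤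
      ∑ i ∈ T, w i := by
  choose! κ hκ using hS
  have huniq : ∀ i ∈ S, ∀ k, i ∈ Mk k → κ i = k := by
    intro i hi k hk
    by_contra h
    exact (Finset.disjoint_left.mp (hdisj _ _ h)) (hκ i hi) hk
  have hrank : ∀ k, rankFn F (S ∩ Mk k) ≤ (T.filter (fun i => κ i ≤ k)).card := by
    intro k
    apply Finset.sup_le
    intro B hB
    obtain ⟨hB1, hB2⟩ : B ⊆ S ∩ Mk k ∧ B ∈ F := by
      simpa only [mem_filter, mem_univ, true_and] using hB
    have hBS : B ⊆ S := fun x hx => (mem_inter.mp (hB1 hx)).1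
    have hBk : ∀ x ∈ B, x ∈ Mk k := fun x hx => (mem_inter.mp (hB1 hx)).2
    refine card_bound F hF w S T hTS hTF hTmax _ B (filter_subset _ _) hBS hB2 ?_ ?_ ?_
    · intro i hi hiT
      exact mem_filter.mpr ⟨hiT, (huniq i (hBS hi) k (hBk i hi)).le⟩
    · intro i hi
      exact lt_trans (by positivity) (hw k i (hBk i hi)).1
    · intro i hi j hj hjA
      have hlt : k + 1 ≤ κ j := by
        by_contra h
        exact hjA (mem_filter.mpr ⟨hj, by omega⟩)
      refine lt_of_le_of_lt ((hw _ j (hκ j (hTS hj))).2.trans ?_) (hw k i (hBk i hi)).1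
      apply one_div_le_one_div_of_le (by positivity)
      gcongr
      norm_num
  have hsum : HasSum (fun k : ℕ => ∑ i ∈ T, if κ i ≤ k then 1 / (2 ^ (k + 1) * C) else 0)
      (∑ i ∈ T, 1 / (2 ^ (κ i) * C)) := hasSum_sum fun i _ => hasSum_tail C (κ i)
  have hle : ∀ k : ℕ, (rankFn F (S ∩ Mk k) : ℝ) / (2 ^ (k + 1) * C) ≤
      ∑ i ∈ T, if κ i ≤ k then 1 / (2 ^ (k + 1) * C) else 0 := by
    intro k
    rw [← sum_filter, sum_const, nsmul_eq_mul, mul_one_div]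
    have : (rankFn F (S ∩ Mk k) : ℝ) ≤ ((T.filter (fun i => κ i ≤ k)).card : ℝ) := by
      exact_mod_cast hrank k
    gcongr
  have hsm : Summable (fun k : ℕ => (rankFn F (S ∩ Mk k) : ℝ) / (2 ^ (k + 1) * C)) :=
    Summable.of_nonneg_of_le (fun k => by positivity) hle hsum.summable
  have h1 := hsm.tsum_le_tsum hle hsum.summable
  rw [hsum.tsum_eq] at h1
  calc _ ≤ (1 / 2) * ∑ i ∈ T, 1 / (2 ^ (κ i) * C) := by gcongr
    _ ≤ _ := by
      rw [mul_sum]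
      refine sum_le_sum fun i hi => ?_
      refine le_trans (le_of_eq ?_) (hw _ i (hκ i (hTS hi))).1.le
      rw [pow_succ]
      field_simp
end

section
/- Let M be a finite set, C > 0, let g : 2^M → ℝ be monotone (g(A) ≤ g(B) whenever A ⊆ B), let F be a matroid on M with rank function r, and let w : M → ℝ_{≥0} satisfy g(S) ≥ (1/2)·Σ_{i∈S} w_i for every S ∈ F. For k ∈ ℕ define M_k := {i ∈ M : 1/(2^{k+1}·C) < w_i ≤ 1/(2^k·C)}. Let S ⊆ ∪_{k∈ℕ} M_k and let d : ℕ → ℕ (with finitely many nonzero values) satisfy r(S ∩ M_k) ≥ d_k for all k ∈ ℕ and Σ_{k∈ℕ} d_k/(2^k·C) ≥ 69/(40C). Then g(S) ≥ 69/(320C). (Lemma 13 with its supporting hypotheses made explicit.) -/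
open Finset
open scoped Classical

theorem augment_aux {M : Type} [DecidableEq M] (F : Set (Finset M)) (hF : IsMatroid F)
    (T : Finset M) (hT : T ∈ F) (n : ℕ) :
    ∀ I ∈ F, T.card ≤ I.card + n → ∃ J ∈ F, I ⊆ J ∧ J ⊆ I ∪ T ∧ T.card ≤ J.card := by
  induction n with
  | zero => exact fun I hI h => ⟨I, hI, Finset.Subset.refl _, Finset.subset_union_left, h⟩
  | succ n ih =>
    intro I hI h
    by_cases hc : T.card ≤ I.card
    · exact ⟨I, hI, Finset.Subset.refl _, Finset.subset_union_left, hc⟩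
    · obtain ⟨i, hi, hins⟩ := hF.2.2 I hI T hT (by omega)
      rw [Finset.mem_sdiff] at hi
      obtain ⟨J, hJ, h1, h2, h3⟩ := ih _ hins (by
        rw [Finset.card_insert_of_notMem hi.2]; omega)
      refine ⟨J, hJ, (Finset.subset_insert _ _).trans h1, h2.trans ?_, h3⟩
      intro x hx
      simp only [Finset.mem_union, Finset.mem_insert] at hx ⊢
      rcases hx with (rfl | hx) | hx
      · exact Or.inr hi.1
      · exact Or.inl hx
      · exact Or.inr hx

theorem rankFn_witness {M : Type} [Fintype M] (F : Set (Finset M)) (hne : ∅ ∈ F)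
    (U : Finset M) : ∃ T ∈ F, T ⊆ U ∧ T.card = rankFn F U := by
  have hn : (Finset.univ.filter (fun S : Finset M => S ⊆ U ∧ S ∈ F)).Nonempty :=
    ⟨∅, by simp [hne]⟩
  obtain ⟨T, hT, h⟩ := Finset.exists_mem_eq_sup _ hn Finset.card
  simp only [Finset.mem_filter] at hT
  exact ⟨T, hT.2.2, hT.2.1, h.symm⟩

/-- Lemma 13 (with its supporting hypotheses made explicit): let `g` be monotone, `F` a
matroid with rank function `r`, and `w ≥ 0` with `g(S) ≥ (1/2) ∑_{i ∈ S} w_i` for every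
`S ∈ F`. If `S ⊆ ∪_k M_k` where `M_k = {i : 1/(2^{k+1} C) < w_i ≤ 1/(2^k C)}`, and
`d : ℕ → ℕ` has finitely many nonzero values, `d_k ≤ r(S ∩ M_k)` for all `k`, and
`∑_k d_k / (2^k C) ≥ 69/(40C)`, then `g(S) ≥ 69/(320 C)`. -/
theorem lemma13_processing_time_bound (M : Type) [Fintype M] [DecidableEq M]
    (C : ℝ) (hC : 0 < C)
    (g : Finset M → ℝ) (hmono : ∀ A B : Finset M, A ⊆ B → g A ≤ g B)
    (F : Set (Finset M)) (hF : IsMatroid F)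
    (w : M → ℝ) (hw0 : ∀ i, 0 ≤ w i)
    (hgw : ∀ S ∈ F, (1 / 2) * ∑ i ∈ S, w i ≤ g S)
    (S : Finset M)
    (hS : ∀ i ∈ S, ∃ k : ℕ, 1 / (2 ^ (k + 1) * C) < w i ∧ w i ≤ 1 / (2 ^ k * C))
    (d : ℕ → ℕ) (hdfin : ∃ N : ℕ, ∀ k, N ≤ k → d k = 0)
    (hdr : ∀ k : ℕ,
      d k ≤ rankFn F (S ∩ Finset.univ.filter
        (fun i => 1 / (2 ^ (k + 1) * C) < w i ∧ w i ≤ 1 / (2 ^ k * C))))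
    (hdsum : 69 / (40 * C) ≤ ∑' k : ℕ, (d k : ℝ) / (2 ^ k * C)) :
    69 / (320 * C) ≤ g S := by
  have hne : ∅ ∈ F := by
    obtain ⟨A, hA⟩ := hF.1
    exact hF.2.1 ∅ A hA (Finset.empty_subset _)
  have key : ∀ n : ℕ, ∃ I ∈ F, I ⊆ S ∧
      (∑ k ∈ Finset.range n, (d k : ℝ) / (2 ^ k * C)) / 4 + (I.card : ℝ) * (1 / (2 ^ (n + 1) * C))
        ≤ ∑ i ∈ I, w i := by
    intro n
    induction n with
    | zero => exact ⟨∅, hne, Finset.empty_subset _, by simp⟩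
    | succ n ih =>
      obtain ⟨I, hI, hIS, hsum⟩ := ih
      obtain ⟨T, hT, hTU, hTc⟩ := rankFn_witness F hne (S ∩ Finset.univ.filter
        (fun i => 1 / (2 ^ (n + 1) * C) < w i ∧ w i ≤ 1 / (2 ^ n * C)))
      obtain ⟨J, hJ, h1, h2, h3⟩ := augment_aux F hF T hT T.card I hI (by omega)
      have hd : d n ≤ J.card := (hdr n).trans (hTc ▸ h3)
      refine ⟨J, hJ, ?_, ?_⟩
      · exact h2.trans (Finset.union_subset hIS (hTU.trans Finset.inter_subset_left))
      · have e1 : ∑ i ∈ J, w i = ∑ i ∈ J \ I, w i + ∑ i ∈ I, w i :=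
          (Finset.sum_sdiff h1).symm
        have e2 : ((J \ I).card : ℝ) + I.card = J.card := by
          exact_mod_cast Finset.card_sdiff_add_card_eq_card h1
        have e3 : ((J \ I).card : ℝ) * (1 / (2 ^ (n + 1) * C)) ≤ ∑ i ∈ J \ I, w i := by
          rw [← nsmul_eq_mul]
          apply Finset.card_nsmul_le_sum
          intro x hx
          rw [Finset.mem_sdiff] at hx
          have hxT : x ∈ T := (Finset.mem_union.1 (h2 hx.1)).resolve_left hx.2
          have := hTU hxT
          simp only [Finset.mem_inter, Finset.mem_filter] at this
          exact this.2.2.1.le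
        have hp : 0 < 1 / (2 ^ n * C) := by positivity
        have a1 : 1 / (2 ^ (n + 1) * C) = 1 / (2 ^ n * C) / 2 := by
          rw [pow_succ]; field_simp
        have a2 : 1 / (2 ^ (n + 1 + 1) * C) = 1 / (2 ^ n * C) / 4 := by
          rw [pow_succ, pow_succ]; field_simp; norm_num
        have a3 : (d n : ℝ) / (2 ^ n * C) = d n * (1 / (2 ^ n * C)) := by ring
        have hd' : (d n : ℝ) * (1 / (2 ^ n * C)) ≤ J.card * (1 / (2 ^ n * C)) :=
          mul_le_mul_of_nonneg_right (by exact_mod_cast hd) hp.le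
        rw [Finset.sum_range_succ, e1, a2, a3]
        rw [a1] at e3 hsum
        rw [← e2] at hd' ⊢
        linarith
  obtain ⟨N, hN⟩ := hdfin
  obtain ⟨I, hI, hIS, hsum⟩ := key N
  rw [tsum_eq_sum (s := Finset.range N) (fun k hk => by
    rw [hN k (by simpa using hk)]; simp)] at hdsum
  have h1 := hgw I hI
  have h2 := hmono I S hIS
  have h3 : 0 ≤ (I.card : ℝ) * (1 / (2 ^ (N + 1) * C)) := by positivity
  have h4 : 69 / (320 * C) = 69 / (40 * C) / 8 := by field_simp; norm_num
  linarith
end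

section
/- Let I be a finite set of items, A a finite set of agents, for each j ∈ A let u_j : 2^I → ℝ_{≥0} with u_j(∅) = 0, let V > 0, and define g_j(S) := min{u_j(S), V}. Then: (i) if (T_j)_{j∈A} is a family of subsets of I such that each item belongs to at most one T_j and u_j(T_j) ≥ V for all j ∈ A, then every T_j is nonempty and Σ_{j∈A : i∈T_j} 1/g_j(T_j) ≤ 1/V for every i ∈ I; (ii) conversely, if α ≥ 1 and (S_j)_{j∈A} is a family of nonempty subsets of I with g_j(S_j) > 0 for all j and Σ_{j∈A : i∈S_j} 1/g_j(S_j) ≤ α/V for every i ∈ I, then u_j(S_j) ≥ V/α for every j ∈ A and |{j ∈ A : i ∈ S_j}| ≤ ⌊α⌋ for every i ∈ I. (Correctness of the reduction in Theorem 3 from Max-min Fair Allocation to the Assignment problem.) -/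
open Finset
open scoped Classical

/-- Correctness of the reduction in Theorem 3 from Max-min Fair Allocation to the
Assignment problem, where `g_j(S) := min {u_j(S), V}`:
(i) a proper allocation `(T_j)` with `u_j(T_j) ≥ V` for all agents has all `T_j`
nonempty and yields machine loads `∑_{j : i ∈ T_j} 1/g_j(T_j) ≤ 1/V`;
(ii) conversely, an assignment `(S_j)` of nonempty sets with `g_j(S_j) > 0` and loads
at most `α/V` gives every agent utility at least `V/α` and assigns every item to at
most `⌊α⌋` agents. -/
theorem mmfa_reduction_correctness (I A : Type) [Fintype I] [Fintype A]
    (u : A → Finset I → ℝ)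
    (hu0 : ∀ j, u j ∅ = 0) (hunn : ∀ (j : A) (S : Finset I), 0 ≤ u j S)
    (V : ℝ) (hV : 0 < V) :
    (∀ T : A → Finset I,
      (∀ i : I, (Finset.univ.filter (fun j => i ∈ T j)).card ≤ 1) →
      (∀ j : A, V ≤ u j (T j)) →
      (∀ j : A, (T j).Nonempty) ∧
        (∀ i : I,
          ∑ j ∈ Finset.univ.filter (fun j => i ∈ T j), (min (u j (T j)) V)⁻¹ ≤ V⁻¹)) ∧
    (∀ α : ℝ, 1 ≤ α → ∀ S : A → Finset I,
      (∀ j : A, (S j).Nonempty) →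
      (∀ j : A, 0 < min (u j (S j)) V) →
      (∀ i : I,
        ∑ j ∈ Finset.univ.filter (fun j => i ∈ S j), (min (u j (S j)) V)⁻¹ ≤ α / V) →
      (∀ j : A, V / α ≤ u j (S j)) ∧
        (∀ i : I, (Finset.univ.filter (fun j => i ∈ S j)).card ≤ ⌊α⌋₊)) := by
  refine ⟨fun T hT hTV => ⟨fun j => ?_, fun i => ?_⟩,
    fun α hα S hS hg hload => ⟨fun j => ?_, fun i => ?_⟩⟩
  · rw [Finset.nonempty_iff_ne_empty]
    intro h
    have h1 := hTV j
    rw [h, hu0] at h1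
    linarith
  · have h1 : ∀ j ∈ Finset.univ.filter (fun j => i ∈ T j),
        (min (u j (T j)) V)⁻¹ = V⁻¹ := fun j _ => by rw [min_eq_right (hTV j)]
    rw [Finset.sum_congr rfl h1, Finset.sum_const, nsmul_eq_mul]
    have h2 : ((Finset.univ.filter (fun j => i ∈ T j)).card : ℝ) ≤ 1 := by
      exact_mod_cast hT i
    have h3 : 0 < V⁻¹ := inv_pos.mpr hV
    nlinarith
  · obtain ⟨i, hi⟩ := hS j
    have h1 : (min (u j (S j)) V)⁻¹ ≤ α / V :=
      le_trans (Finset.single_le_sum (f := fun j => (min (u j (S j)) V)⁻¹)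
        (fun k _ => (inv_pos.mpr (hg k)).le) (by simpa using hi)) (hload i)
    have h2 : (α / V)⁻¹ ≤ min (u j (S j)) V :=
      inv_le_of_inv_le₀ (hg j) h1
    rw [inv_div] at h2
    exact h2.trans (min_le_left _ _)
  · apply Nat.le_floor
    have h1 : ∑ j ∈ Finset.univ.filter (fun j => i ∈ S j), V⁻¹ ≤ α / V :=
      le_trans (Finset.sum_le_sum fun j _ =>
        inv_anti₀ (hg j) (min_le_right _ _)) (hload i)
    rw [Finset.sum_const, nsmul_eq_mul, ← div_eq_mul_inv] at h1
    exact (div_le_div_iff_of_pos_right hV).mp h1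
end
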